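/- A generic endomorphism f of ℂⁿ (n ≥ 1) is chaotic on its Julia set in the sense of Touhey: for every pair of nonempty open sets U, V ⊆ ℂⁿ each intersecting J_f, there exists a repelling periodic point of f whose (finite) orbit intersects both U and V. (Proposition 2.15 of the paper, proved for Oka-Stein manifolds; specialized to ℂⁿ.) -/

import Mathlib

open Function Topology Filter Metric

noncomputable section

/-- `ℂⁿ` as a Euclidean space. -/
abbrev Cn (n : ℕ) := EuclideanSpace ℂ (Fin n)

/-- The space `End(ℂⁿ)` of holomorphic self-maps of `ℂⁿ`, topologized as a subspace of
the continuous maps `C(ℂⁿ, ℂⁿ)` with the compact-open topology. -/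
abbrev Endo (n : ℕ) := {f : C(Cn n, Cn n) // Differentiable ℂ ⇑f}

variable {n : ℕ}

/-- The underlying function of an endomorphism. -/
def eapp (f : Endo n) : Cn n → Cn n := ⇑f.1

/-- `p` is a periodic point of `f`. -/
def IsPer (f : Endo n) (p : Cn n) : Prop := ∃ m, 1 ≤ m ∧ (eapp f)^[m] p = p

/-- The minimal period of a periodic point. -/
def minPer (f : Endo n) (p : Cn n) : ℕ := Function.minimalPeriod (eapp f) p

/-- The eigenvalues at a periodic point `p`: the spectrum of the derivative of the
`minPer f p`-th iterate at `p`. -/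
def eigs (f : Endo n) (p : Cn n) : Set ℂ := spectrum ℂ (fderiv ℂ ((eapp f)^[minPer f p]) p)

/-- Hyperbolic periodic point: no eigenvalue of absolute value 1. -/
def IsHypPer (f : Endo n) (p : Cn n) : Prop := IsPer f p ∧ ∀ z ∈ eigs f p, ‖z‖ ≠ 1

/-- Attracting periodic point: all eigenvalues of absolute value < 1. -/
def IsAttPer (f : Endo n) (p : Cn n) : Prop := IsPer f p ∧ ∀ z ∈ eigs f p, ‖z‖ < 1

/-- Repelling periodic point: all eigenvalues of absolute value > 1. -/
def IsRepPer (f : Endo n) (p : Cn n) : Prop := IsPer f p ∧ ∀ z ∈ eigs f p, 1 < ‖z‖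

/-- Saddle periodic point: hyperbolic with eigenvalues of absolute value both < 1 and > 1. -/
def IsSadPer (f : Endo n) (p : Cn n) : Prop :=
  IsHypPer f p ∧ (∃ z ∈ eigs f p, ‖z‖ < 1) ∧ (∃ z ∈ eigs f p, 1 < ‖z‖)

/-- Super-attracting periodic point: the derivative of the `minPer`-th iterate vanishes. -/
def IsSuperAttPer (f : Endo n) (p : Cn n) : Prop :=
  IsPer f p ∧ fderiv ℂ ((eapp f)^[minPer f p]) p = 0

/-- The set of attracting periodic points of `f`. -/
def attSet (f : Endo n) : Set (Cn n) := {p | IsAttPer f p}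

/-- The set of repelling periodic points of `f`. -/
def repSet (f : Endo n) : Set (Cn n) := {p | IsRepPer f p}

/-- The set of saddle periodic points of `f`. -/
def sadSet (f : Endo n) : Set (Cn n) := {p | IsSadPer f p}

/-- The robustly non-expelling set of `f`. -/
def rne (f : Endo n) : Set (Cn n) :=
  {p | ∃ U : Set (Cn n), IsOpen U ∧ p ∈ U ∧ ∃ V ∈ 𝓝 f, ∃ K : Set (Cn n),
        IsCompact K ∧ ∀ g ∈ V, ∀ j : ℕ, (eapp g)^[j] '' U ⊆ K}

/-- A sequence of maps diverges locally uniformly to infinity on `U`. -/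
def DivLocUnifOn (F : ℕ → Cn n → Cn n) (U : Set (Cn n)) : Prop :=
  ∀ L ⊆ U, IsCompact L → ∀ K : Set (Cn n), IsCompact K →
    ∀ᶠ j in atTop, Disjoint (F j '' L) K

/-- `p` belongs to the Fatou set of `f`: the iterates form a normal family near `p`. -/
def FatouAt (f : Endo n) (p : Cn n) : Prop :=
  ∃ U : Set (Cn n), IsOpen U ∧ p ∈ U ∧
    ∀ k : ℕ → ℕ, StrictMono k → ∃ l : ℕ → ℕ, StrictMono l ∧
      ((∃ g : Cn n → Cn n, DifferentiableOn ℂ g U ∧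
          TendstoLocallyUniformlyOn (fun j => (eapp f)^[k (l j)]) g atTop U) ∨
        DivLocUnifOn (fun j => (eapp f)^[k (l j)]) U)

/-- The Fatou set of `f`. -/
def Fatou (f : Endo n) : Set (Cn n) := {p | FatouAt f p}

/-- The Julia set of `f`. -/
def Julia (f : Endo n) : Set (Cn n) := (Fatou f)ᶜ

/-- The cycle (finite orbit) of a periodic point `p`. -/
def cycleOf (f : Endo n) (p : Cn n) : Set (Cn n) := {x | ∃ i < minPer f p, (eapp f)^[i] p = x}

/-- The basin of attraction of the cycle of `p`. -/
def basinOf (f : Endo n) (p : Cn n) : Set (Cn n) :=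
  {x | ∃ a ∈ cycleOf f p, Tendsto (fun k => (eapp f)^[minPer f p * k] x) atTop (𝓝 a)}

/-- The non-wandering set of `f`. -/
def nonWandering (f : Endo n) : Set (Cn n) :=
  {p | ∀ U ∈ 𝓝 p, ∃ k, 1 ≤ k ∧ (U ∩ (eapp f)^[k] '' U).Nonempty}

/-- The set of points whose orbit can be closed in the weak sense. -/
def cloSet (f : Endo n) : Set (Cn n) :=
  {p | ∀ U ∈ 𝓝 p, ∀ V ∈ 𝓝 f, ∃ g ∈ V, ∃ q ∈ U, IsPer g q}

/-- `𝒯(m,K)`: endomorphisms all of whose periodic points in `K` of minimal period at most `m`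
are transverse. -/
def TransSet (n : ℕ) (m : ℕ) (K : Set (Cn n)) : Set (Endo n) :=
  {f | ∀ p ∈ K, IsPer f p → minPer f p ≤ m → (1 : ℂ) ∉ eigs f p}

/-- `ℋ(m,K)`: endomorphisms all of whose periodic points in `K` of minimal period at most `m`
are hyperbolic. -/
def HypSet (n : ℕ) (m : ℕ) (K : Set (Cn n)) : Set (Endo n) :=
  {f | ∀ p ∈ K, IsPer f p → minPer f p ≤ m → ∀ z ∈ eigs f p, ‖z‖ ≠ 1}

/-- The `m`-th iterate of an endomorphism as an endomorphism. -/
def iterEndo (f : Endo n) (m : ℕ) : Endo n :=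
  ⟨⟨(eapp f)^[m], f.1.continuous.iterate m⟩, f.2.iterate m⟩

/-- The set of points with relatively compact forward orbit. -/
def boundedOrb (f : Endo n) : Set (Cn n) :=
  {p | ∃ K : Set (Cn n), IsCompact K ∧ ∀ k : ℕ, (eapp f)^[k] p ∈ K}

/-- An `ε`-chain (pseudo-orbit) of `f` from `x` to `y`. -/
def EpsChain (f : Endo n) (ε : Cn n → ℝ) (x y : Cn n) : Prop :=
  ∃ N : ℕ, 1 ≤ N ∧ ∃ c : ℕ → Cn n, c 0 = x ∧ c N = y ∧
    ∀ j < N, dist (eapp f (c j)) (c (j + 1)) < ε (eapp f (c j))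

/-- `x` and `y` are chain-equivalent for `f`. -/
def ChainEquiv (f : Endo n) (x y : Cn n) : Prop :=
  ∀ ε : Cn n → ℝ, Continuous ε → (∀ z, 0 < ε z) → EpsChain f ε x y ∧ EpsChain f ε y x

/-- `x` is chain-recurrent for `f`. -/
def ChainRec (f : Endo n) (x : Cn n) : Prop :=
  ∀ ε : Cn n → ℝ, Continuous ε → (∀ z, 0 < ε z) → EpsChain f ε x x

/-- Attracting fixed point. -/
def IsAttFix (f : Endo n) (p : Cn n) : Prop :=
  eapp f p = p ∧ ∀ z ∈ spectrum ℂ (fderiv ℂ (eapp f) p), ‖z‖ < 1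

/-- Repelling fixed point. -/
def IsRepFix (f : Endo n) (p : Cn n) : Prop :=
  eapp f p = p ∧ ∀ z ∈ spectrum ℂ (fderiv ℂ (eapp f) p), 1 < ‖z‖

/-- Saddle fixed point. -/
def IsSadFix (f : Endo n) (p : Cn n) : Prop :=
  eapp f p = p ∧ (∀ z ∈ spectrum ℂ (fderiv ℂ (eapp f) p), ‖z‖ ≠ 1) ∧
    (∃ z ∈ spectrum ℂ (fderiv ℂ (eapp f) p), ‖z‖ < 1) ∧
    (∃ z ∈ spectrum ℂ (fderiv ℂ (eapp f) p), 1 < ‖z‖)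

/-- `f` is a local biholomorphism at `p`: `f` agrees near `p` with a homeomorphism onto an
open set whose inverse is holomorphic. -/
def LocalBiholoAt (f : Endo n) (p : Cn n) : Prop :=
  ∃ φ : PartialHomeomorph (Cn n) (Cn n), p ∈ φ.source ∧ Set.EqOn (eapp f) φ φ.source ∧
    DifferentiableOn ℂ φ.symm φ.target

lemma eapp_diff (f : Endo n) : Differentiable ℂ (eapp f) := f.2

lemma iter_diff (f : Endo n) (k : ℕ) : Differentiable ℂ ((eapp f)^[k]) := f.2.iterate k

lemma cauchy_est {F : Cn n → Cn n} (hF : Differentiable ℂ F) {z : Cn n} {r M : ℝ} (hr : 0 < r)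
    (hM : ∀ w ∈ closedBall z r, ‖F w‖ ≤ M) : ‖fderiv ℂ F z‖ ≤ M / r := by
  have hM0 : 0 ≤ M := (norm_nonneg _).trans (hM z (mem_closedBall_self hr.le))
  refine ContinuousLinearMap.opNorm_le_of_unit_norm (𝕜 := ℂ) (by positivity) ?_
  intro v hv
  have hd : HasDerivAt (fun t : ℂ => F (z + t • v)) (fderiv ℂ F z v) 0 := by
    have h1 : HasDerivAt (fun t : ℂ => z + t • v) v 0 := by
      simpa using ((hasDerivAt_id (0 : ℂ)).smul_const v).const_add z
    have h2 : HasFDerivAt F (fderiv ℂ F z) (z + (0 : ℂ) • v) := by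
      simpa using (hF z).hasFDerivAt
    exact h2.comp_hasDerivAt (0 : ℂ) h1
  rw [← hd.deriv]
  refine Complex.norm_deriv_le_of_forall_mem_sphere_norm_le hr ?_ ?_
  · apply Differentiable.diffContOnCl
    fun_prop
  · intro t ht
    apply hM
    rw [mem_sphere_zero_iff_norm] at ht
    simp [norm_smul, ht, hv]

lemma ev_close (f : Endo n) {K : Set (Cn n)} (hK : IsCompact K) {ε : ℝ} (hε : 0 < ε) :
    ∀ᶠ g in 𝓝 f, ∀ w ∈ K, dist (eapp f w) (eapp g w) < ε := by
  have h : Tendsto (fun g : Endo n => g.1) (𝓝 f) (𝓝 f.1) := continuous_subtype_val.continuousAt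
  have := ContinuousMap.tendsto_iff_forall_isCompact_tendstoUniformlyOn.1 h K hK
  exact Metric.tendstoUniformlyOn_iff.1 this ε hε

lemma cont_fderiv_endo (z : Cn n) : Continuous (fun g : Endo n => fderiv ℂ (eapp g) z) := by
  rw [continuous_iff_continuousAt]
  intro f
  rw [ContinuousAt, Metric.tendsto_nhds]
  intro ε hε
  filter_upwards [ev_close f (isCompact_closedBall z 1) (half_pos hε)] with g hg
  rw [dist_eq_norm, ← fderiv_sub (eapp_diff g z) (eapp_diff f z)]
  have := cauchy_est (F := eapp g - eapp f) ((eapp_diff g).sub (eapp_diff f)) (z := z)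
    (M := ε / 2) one_pos (by
      intro w hw
      have := hg w hw
      rw [dist_comm, dist_eq_norm] at this
      exact this.le)
  linarith

lemma cont_fderiv {F : Cn n → Cn n} (hF : Differentiable ℂ F) : Continuous (fderiv ℂ F) := by
  let T : Cn n → Endo n := fun z => ⟨⟨fun w => F (w + z), by
    have := hF.continuous; fun_prop⟩, by
      change Differentiable ℂ (fun w => F (w + z)); fun_prop⟩
  have hT : Continuous T := by
    apply Continuous.subtype_mk
    apply ContinuousMap.continuous_of_continuous_uncurry
    have := hF.continuous
    change Continuous (fun p : Cn n × Cn n => F (p.2 + p.1))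
    fun_prop
  have := (cont_fderiv_endo (0 : Cn n)).comp hT
  convert this using 1
  ext1 z
  change _ = fderiv ℂ (fun w => F (w + z)) 0
  rw [fderiv_comp_add_right]; simp

lemma cont_iterEndo (m : ℕ) : Continuous (fun g : Endo n => iterEndo g m) := by
  apply Continuous.subtype_mk
  induction m with
  | zero => exact continuous_const (y := ContinuousMap.id (Cn n))
  | succ m ih =>
    have : Continuous (fun g : Endo n => (g.1, (iterEndo g m).1)) :=
      continuous_subtype_val.prodMk ih
    exact ContinuousMap.continuous_comp'.comp this

lemma rep_of {g : Endo n} {m : ℕ} (hm : 1 ≤ m) {p : Cn n} (hp : (eapp g)^[m] p = p)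
    (hD : ‖fderiv ℂ ((eapp g)^[m]) p - (2 : ℂ) • ContinuousLinearMap.id ℂ (Cn n)‖ ≤ 1 / 2) :
    IsRepPer g p := by
  refine ⟨⟨m, hm, hp⟩, ?_⟩
  intro z hz
  have hper : IsPeriodicPt (eapp g) m p := hp
  obtain ⟨k, hk⟩ := hper.minimalPeriod_dvd
  have hit : (eapp g)^[m] = ((eapp g)^[minPer g p])^[k] := by
    rw [hk, Function.iterate_mul]; rfl
  have hfix : (eapp g)^[minPer g p] p = p := isPeriodicPt_minimalPeriod (eapp g) p
  have hder : fderiv ℂ ((eapp g)^[m]) p = (fderiv ℂ ((eapp g)^[minPer g p]) p) ^ k := by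
    rw [hit]
    exact ((iter_diff g _ p).hasFDerivAt.iterate hfix k).fderiv
  have hzk : z ^ k ∈ spectrum ℂ (fderiv ℂ ((eapp g)^[m]) p) := by
    rw [hder]; exact spectrum.pow_mem_pow _ k hz
  have h2 : ‖z ^ k - 2‖ ≤ 1 / 2 := by
    have hn : Nontrivial (Cn n →L[ℂ] Cn n) := by
      by_contra hcon
      rw [not_nontrivial_iff_subsingleton] at hcon
      rw [spectrum.of_subsingleton] at hzk
      exact hzk
    have h3 : z ^ k - 2 ∈ spectrum ℂ (fderiv ℂ ((eapp g)^[m]) p -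
        algebraMap ℂ (Cn n →L[ℂ] Cn n) 2) := by
      exact spectrum.sub_singleton_eq (fderiv ℂ ((eapp g)^[m]) p) (2:ℂ) ▸ 
        Set.sub_mem_sub hzk rfl
    rw [Algebra.algebraMap_eq_smul_one] at h3
    have : NormOneClass (Cn n →L[ℂ] Cn n) := by
      refine ⟨?_⟩
      have : Nontrivial (Cn n) := by
        by_contra hcon
        rw [not_nontrivial_iff_subsingleton] at hcon
        exact not_subsingleton (Cn n →L[ℂ] Cn n) inferInstance
      exact ContinuousLinearMap.norm_id
    exact (spectrum.norm_le_norm_of_mem h3).trans hD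
  have h4 : 1 < ‖z‖ ^ k := by
    rw [← norm_pow]
    have := norm_sub_norm_le (2 : ℂ) (z ^ k)
    rw [norm_sub_rev] at this
    simp only [Complex.norm_ofNat] at this
    linarith
  by_contra hcon
  exact absurd h4 (not_lt.2 (pow_le_one₀ (norm_nonneg _) (not_lt.1 hcon)))

/-- target property -/
def HasCyc (f : Endo n) (U V : Set (Cn n)) : Prop :=
  ∃ p : Cn n, IsRepPer f p ∧ (∃ i < minPer f p, (eapp f)^[i] p ∈ U) ∧
        (∃ j < minPer f p, (eapp f)^[j] p ∈ V)

lemma hasCyc_of {g : Endo n} {m j : ℕ} (hm : 1 ≤ m) {p : Cn n} (hp : (eapp g)^[m] p = p)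
    (hD : ‖fderiv ℂ ((eapp g)^[m]) p - (2 : ℂ) • ContinuousLinearMap.id ℂ (Cn n)‖ ≤ 1 / 2)
    {U V : Set (Cn n)} (hU : p ∈ U) (hV : (eapp g)^[j] p ∈ V) : HasCyc g U V := by
  have hpos : 0 < minPer g p := IsPeriodicPt.minimalPeriod_pos hm hp
  refine ⟨p, rep_of hm hp hD, ⟨0, hpos, hU⟩, j % minPer g p, Nat.mod_lt _ hpos, ?_⟩
  rwa [minPer, Function.iterate_mod_minimalPeriod_eq]

lemma robust {g : Endo n} {m j : ℕ} (hm : 1 ≤ m) {x : Cn n} (hx : (eapp g)^[m] x = x)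
    (hD : fderiv ℂ ((eapp g)^[m]) x = (2 : ℂ) • ContinuousLinearMap.id ℂ (Cn n))
    {U V : Set (Cn n)} (oU : IsOpen U) (oV : IsOpen V)
    (hU : x ∈ U) (hV : (eapp g)^[j] x ∈ V) : ∀ᶠ g' in 𝓝 g, HasCyc g' U V := by
  have e1 : ∀ᶠ z in 𝓝 x, z ∈ U ∧ (eapp g)^[j] z ∈ V ∧
      ‖fderiv ℂ ((eapp g)^[m]) z - (2 : ℂ) • ContinuousLinearMap.id ℂ (Cn n)‖ < 1 / 4 := by
    refine (oU.eventually_mem hU).and (((iter_diff g j).continuous.continuousAt.eventually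
      (oV.mem_nhds hV)).and ?_)
    have hc : Continuous (fun z => ‖fderiv ℂ ((eapp g)^[m]) z -
      (2 : ℂ) • ContinuousLinearMap.id ℂ (Cn n)‖) :=
      ((cont_fderiv (iter_diff g m)).sub continuous_const).norm
    refine hc.continuousAt.eventually_lt continuousAt_const ?_
    simp only [hD, sub_self, norm_zero]; norm_num
  obtain ⟨r, hr, hball⟩ := Metric.nhds_basis_closedBall.eventually_iff.1 e1
  have e2 : ∀ᶠ g' in 𝓝 g, Set.MapsTo ((eapp g')^[j]) (closedBall x r) V := by
    have : ContinuousAt (fun g : Endo n => (iterEndo g j).1) g :=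
      (continuous_subtype_val.comp (cont_iterEndo j)).continuousAt
    exact this.eventually (ContinuousMap.eventually_mapsTo (isCompact_closedBall x r) oV
      (fun z hz => (hball hz).2.1))
  have e3 := (cont_iterEndo (n := n) m).continuousAt.eventually 
    (ev_close (iterEndo g m) (isCompact_closedBall x (r + 1)) (ε := min (1/4) (r/2)) (by positivity))
  filter_upwards [e2, e3] with g' h2 h3
  have h3' : ∀ w ∈ closedBall x (r+1), ‖(eapp g')^[m] w - (eapp g)^[m] w‖ ≤ min (1/4) (r/2) := by
    intro w hw
    have := h3 w hw
    rw [dist_comm, dist_eq_norm] at this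
    exact this.le
  have hder : ∀ z ∈ closedBall x r, 
      ‖fderiv ℂ ((eapp g')^[m]) z - (2 : ℂ) • ContinuousLinearMap.id ℂ (Cn n)‖ ≤ 1 / 2 := by
    intro z hz
    have c := cauchy_est (F := (eapp g')^[m] - (eapp g)^[m]) 
      ((iter_diff g' m).sub (iter_diff g m)) (z := z) (M := 1/4) one_pos (by
        intro w hw
        refine (h3' w ?_).trans (min_le_left _ _)
        rw [mem_closedBall] at *
        linarith [dist_triangle w z x])
    rw [fderiv_sub (iter_diff g' m z) (iter_diff g m z)] at c
    have c2 := (hball hz).2.2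
    have := norm_add_le (fderiv ℂ ((eapp g')^[m]) z - fderiv ℂ ((eapp g)^[m]) z)
      (fderiv ℂ ((eapp g)^[m]) z - (2 : ℂ) • ContinuousLinearMap.id ℂ (Cn n))
    rw [sub_add_sub_cancel] at this
    linarith
  let T : Cn n → Cn n := fun z => (2 : ℂ) • z - (eapp g')^[m] z
  have hTd : ∀ z, HasFDerivAt T ((2 : ℂ) • ContinuousLinearMap.id ℂ (Cn n) -
      fderiv ℂ ((eapp g')^[m]) z) z := fun z =>
    ((hasFDerivAt_id z).const_smul (2 : ℂ)).sub (iter_diff g' m z).hasFDerivAt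
  have hlip : ∀ a ∈ closedBall x r, ∀ b ∈ closedBall x r, ‖T b - T a‖ ≤ 1/2 * ‖b - a‖ := by
    intro a ha b hb
    refine Convex.norm_image_sub_le_of_norm_hasFDerivWithin_le (𝕜 := ℂ) 
      (fun z _ => (hTd z).hasFDerivWithinAt) ?_ (convex_closedBall x r) ha hb
    intro z hz
    rw [norm_sub_rev]; exact hder z hz
  have hxT : ‖T x - x‖ ≤ r / 2 := by
    have := (h3' x (mem_closedBall_self (by linarith))).trans (min_le_right _ _)
    rw [hx, norm_sub_rev] at this
    have e : T x - x = x - (eapp g')^[m] x := by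
      change (2 : ℂ) • x - (eapp g')^[m] x - x = _
      rw [two_smul]; abel
    rwa [e]
  have hmaps : Set.MapsTo T (closedBall x r) (closedBall x r) := by
    intro z hz
    have h1 := hlip x (mem_closedBall_self hr.le) z hz
    rw [mem_closedBall, dist_eq_norm] at *
    have := norm_add_le (T z - T x) (T x - x)
    rw [sub_add_sub_cancel] at this
    linarith
  obtain ⟨p, hp, hfix, -⟩ := ContractingWith.exists_fixedPoint' (f := T) (K := 1/2) 
    (isClosed_closedBall.isComplete) hmaps ⟨by 
      rw [← NNReal.coe_lt_coe]; norm_num, by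
      refine LipschitzWith.of_dist_le_mul ?_
      rintro ⟨a, ha⟩ ⟨b, hb⟩
      have := hlip b hb a ha
      simpa [Subtype.dist_eq, dist_eq_norm] using this⟩ (mem_closedBall_self hr.le)
      (edist_ne_top _ _)
  have hfix' : (eapp g')^[m] p = p := by
    have : (2 : ℂ) • p - (eapp g')^[m] p = p := hfix
    rw [two_smul, sub_eq_iff_eq_add] at this
    exact (add_left_cancel this).symm
  exact hasCyc_of hm hfix' (hder p hp) (hball hp).1 (h2 hp)

lemma exists_bump (a : Cn n) (S : Set (Cn n)) (hS : S.Finite) (haS : a ∉ S) {R : ℝ} (hR : 0 < R)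
    (haR : R < ‖a‖) {δ : ℝ} (hδ : 0 < δ) :
    ∃ b : Cn n → ℂ, Differentiable ℂ b ∧ b a = 1 ∧ (∀ s ∈ S, b s = 0) ∧
      ∀ z ∈ closedBall (0 : Cn n) R, ‖b z‖ ≤ δ := by
  have hQ : ∃ Q : Cn n → ℂ, Differentiable ℂ Q ∧ Q a = 1 ∧ ∀ s ∈ S, Q s = 0 := by
    revert haS
    induction S, hS using Set.Finite.induction_on with
    | empty => exact fun _ => ⟨fun _ => 1, by fun_prop, rfl, by simp⟩
    | @insert s S hs hS ih =>
      intro ha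
      rw [Set.mem_insert_iff, not_or] at ha
      obtain ⟨Q, h1, h2, h3⟩ := ih ha.2
      have hne : inner ℂ (a - s) (a - s) ≠ 0 := by
        rw [Ne, inner_self_eq_zero, sub_eq_zero]; exact ha.1
      refine ⟨fun z => Q z * (innerSL ℂ (a - s) (z - s) / inner ℂ (a - s) (a - s)),
        by fun_prop, ?_, ?_⟩
      · simp only [innerSL_apply_apply]; rw [h2, div_self hne, one_mul]
      · intro t ht
        rcases Set.mem_insert_iff.1 ht with rfl | ht
        · simp
        · simp [h3 t ht]
  obtain ⟨Q, h1, h2, h3⟩ := hQ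
  obtain ⟨M, hM⟩ := (isCompact_closedBall (0 : Cn n) R).exists_bound_of_continuousOn
    h1.continuous.continuousOn
  have ha0 : 0 < ‖a‖ := hR.trans haR
  have hθ : R / ‖a‖ < 1 := (div_lt_one ha0).2 haR
  have hlim : Tendsto (fun N : ℕ => (R / ‖a‖) ^ N * M) atTop (𝓝 (0 * M)) :=
    (tendsto_pow_atTop_nhds_zero_of_lt_one (by positivity) hθ).mul_const M
  rw [zero_mul] at hlim
  obtain ⟨N, hN⟩ := (hlim.eventually (Iio_mem_nhds hδ)).exists
  have hne : inner ℂ a a ≠ 0 := by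
    rw [Ne, inner_self_eq_zero]; exact norm_pos_iff.1 ha0
  refine ⟨fun z => (innerSL ℂ a z / inner ℂ a a) ^ N * Q z, by fun_prop, ?_, ?_, ?_⟩
  · simp only [innerSL_apply_apply]; rw [h2, div_self hne, one_pow, one_mul]
  · intro s hs; simp [h3 s hs]
  · intro z hz
    have hz' : ‖z‖ ≤ R := by simpa using hz
    rw [norm_mul, norm_pow]
    refine le_trans ?_ (le_of_lt hN)
    refine mul_le_mul ?_ (hM z hz) (norm_nonneg _) (by positivity)
    refine pow_le_pow_left₀ (norm_nonneg _) ?_ _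
    rw [norm_div, innerSL_apply_apply, inner_self_eq_norm_sq_to_K]
    have : ‖inner ℂ a z‖ ≤ ‖a‖ * R := (norm_inner_le_norm a z).trans (by gcongr)
    rw [norm_pow]
    simp only [Complex.coe_algebraMap, Complex.norm_real, norm_norm]
    rw [div_le_div_iff₀ (by positivity) ha0]
    nlinarith

lemma exists_pert (a : Cn n) (S : Set (Cn n)) (hS : S.Finite) (haS : a ∉ S) {R : ℝ} (hR : 0 < R)
    (haR : R < ‖a‖) {ε : ℝ} (hε : 0 < ε) (v : Cn n) (L : Cn n →L[ℂ] Cn n) :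
    ∃ h : Cn n → Cn n, Differentiable ℂ h ∧ h a = v ∧ fderiv ℂ h a = L ∧
      (∀ s ∈ S, h s = 0 ∧ fderiv ℂ h s = 0) ∧
      ∀ z ∈ closedBall (0 : Cn n) R, ‖h z‖ ≤ ε := by
  obtain ⟨M, hM⟩ := (isCompact_closedBall (0 : Cn n) R).exists_bound_of_continuousOn
    (f := fun z => v + L (z - a)) (by fun_prop)
  have hM0 : 0 ≤ M := (norm_nonneg _).trans (hM 0 (mem_closedBall_self hR.le))
  have hlim : Tendsto (fun δ : ℝ => (3 * δ ^ 2 + 2 * δ ^ 3) * M) (𝓝[>] 0) (𝓝 0) := by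
    apply tendsto_nhdsWithin_of_tendsto_nhds
    have : Continuous (fun δ : ℝ => (3 * δ ^ 2 + 2 * δ ^ 3) * M) := by fun_prop
    simpa using this.tendsto 0
  obtain ⟨δ, hδε, hδ⟩ := ((hlim.eventually (Iio_mem_nhds hε)).and self_mem_nhdsWithin).exists
  obtain ⟨b, hb, ba, bS, bR⟩ := exists_bump a S hS haS hR haR hδ
  have hder : ∀ z, HasFDerivAt (fun z => (3 * b z ^ 2 - 2 * b z ^ 3) • (v + L (z - a)))
      ((3 * b z ^ 2 - 2 * b z ^ 3) • L + 
        ((6 * b z * (1 - b z)) • fderiv ℂ b z).smulRight (v + L (z - a))) z := by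
    intro z
    have h0 := (hb z).hasFDerivAt
    have h1 : HasFDerivAt (fun z => 3 * b z ^ 2 - 2 * b z ^ 3)
        ((6 * b z * (1 - b z)) • fderiv ℂ b z) z := by
      refine (((h0.pow 2).const_mul (3 : ℂ)).sub ((h0.pow 3).const_mul (2 : ℂ))).congr_fderiv ?_
      ext w
      simp
      ring
    have h2 : HasFDerivAt (fun z => v + L (z - a)) L z :=
      (L.hasFDerivAt.comp z ((hasFDerivAt_id z).sub_const a)).const_add v
    exact h1.smul h2
  refine ⟨_, fun z => (hder z).differentiableAt, ?_, ?_, ?_, ?_⟩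
  · simp [ba]; norm_num
  · rw [(hder a).fderiv, ba]; ext w; simp; norm_num
  · intro s hs
    rw [(hder s).fderiv, bS s hs]
    refine ⟨by simp, ?_⟩
    ext w; simp
  · intro z hz
    rw [norm_smul]
    refine le_trans ?_ (le_of_lt hδε)
    refine mul_le_mul ?_ (hM z hz) (norm_nonneg _) (by have : 0 < δ := hδ; positivity)
    refine (norm_sub_le _ _).trans ?_
    rw [norm_mul, norm_mul, norm_pow, norm_pow]
    simp only [Complex.norm_ofNat]
    have := bR z hz
    gcongr

lemma fatou_of_bdd (f : Endo n) {U : Set (Cn n)} (oU : IsOpen U) {p : Cn n} (hp : p ∈ U) {R : ℝ}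
    (hb : ∀ k, ∀ x ∈ U, ‖(eapp f)^[k] x‖ ≤ R) : FatouAt f p := by
  obtain ⟨r', hr', hball'⟩ := Metric.nhds_basis_closedBall.mem_iff.1 (oU.mem_nhds hp)
  obtain ⟨r, rfl⟩ : ∃ r, r' = 3 * r := ⟨r' / 3, by ring⟩
  have hr : 0 < r := by linarith
  have hR0 : 0 ≤ R := (norm_nonneg _).trans (hb 0 p hp)
  refine ⟨ball p r, isOpen_ball, mem_ball_self hr, ?_⟩
  intro k hk
  have hlip : ∀ j, ∀ x ∈ closedBall p (2 * r), ∀ y ∈ closedBall p (2 * r),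
      ‖(eapp f)^[j] y - (eapp f)^[j] x‖ ≤ R / r * ‖y - x‖ := by
    intro j x hx y hy
    refine Convex.norm_image_sub_le_of_norm_fderiv_le (𝕜 := ℂ) 
      (fun z _ => iter_diff f j z) ?_ (convex_closedBall p (2*r)) hx hy
    intro z hz
    refine cauchy_est (iter_diff f j) hr ?_
    intro w hw
    apply hb j
    apply hball'
    rw [mem_closedBall] at *
    linarith [dist_triangle w z p]
  let X := closedBall p (2 * r)
  have : CompactSpace X := isCompact_iff_compactSpace.1 (isCompact_closedBall p (2 * r))
  let G : ℕ → BoundedContinuousFunction X (Cn n) := fun j => BoundedContinuousFunction.mkOfCompact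
    ⟨fun x => (eapp f)^[k j] x, (iter_diff f (k j)).continuous.comp continuous_subtype_val⟩
  have hsub : X ⊆ U := (closedBall_subset_closedBall (by linarith)).trans hball'
  have hcpt : IsCompact (closure (Set.range G)) := by
    apply BoundedContinuousFunction.arzela_ascoli (closedBall (0 : Cn n) R)
      (isCompact_closedBall _ _)
    · rintro _ x ⟨j, rfl⟩
      rw [mem_closedBall_zero_iff]
      exact hb (k j) x (hsub x.2)
    · refine Metric.equicontinuous_of_continuity_modulus (fun t => R / r * t) ?_ _ ?_
      · have : Continuous (fun t : ℝ => R / r * t) := by fun_prop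
        simpa using this.tendsto 0
      · rintro ⟨x, hx⟩ ⟨y, hy⟩ ⟨_, j, rfl⟩
        rw [dist_eq_norm, Subtype.dist_eq, dist_eq_norm]
        exact hlip (k j) y hy x hx
  obtain ⟨g, -, l, hl, hlim⟩ := hcpt.tendsto_subseq
    (fun j => subset_closure (Set.mem_range_self j))
  refine ⟨l, hl, Or.inl ?_⟩
  classical
  let g0 : Cn n → Cn n := fun z => if h : z ∈ X then g ⟨z, h⟩ else 0
  have hunif : TendstoUniformlyOn (fun j => (eapp f)^[k (l j)]) g0 atTop X := by
    have := BoundedContinuousFunction.tendsto_iff_tendstoUniformly.1 hlim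
    rw [Metric.tendstoUniformly_iff] at this
    rw [Metric.tendstoUniformlyOn_iff]
    intro ε hε
    filter_upwards [this ε hε] with j hj x hx
    have := hj ⟨x, hx⟩
    simp only [g0, dif_pos hx]
    exact this
  have hsub2 : ball p r ⊆ X := ball_subset_closedBall.trans (closedBall_subset_closedBall (by linarith))
  have hc : UniformCauchySeqOn (fun j => fderiv ℂ ((eapp f)^[k (l j)])) atTop (ball p r) := by
    have := hunif.uniformCauchySeqOn
    rw [Metric.uniformCauchySeqOn_iff] at this ⊢
    intro ε hε
    obtain ⟨N, hN⟩ := this (ε / 2 * r) (by positivity)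
    refine ⟨N, fun i hi j hj z hz => ?_⟩
    rw [dist_eq_norm, ← fderiv_sub (iter_diff f _ z) (iter_diff f _ z)]
    have := cauchy_est (F := (eapp f)^[k (l i)] - (eapp f)^[k (l j)]) 
      ((iter_diff f _).sub (iter_diff f _)) (z := z) (M := ε / 2 * r) hr (by
        intro w hw
        have h := hN i hi j hj w (by
          rw [mem_closedBall] at *
          rw [mem_ball] at hz
          linarith [dist_triangle w z p])
        rw [dist_eq_norm] at h
        exact h.le)
    rw [mul_div_assoc, div_self hr.ne', mul_one] at this
    linarith
  have hg' : ∀ z, ∃ A, z ∈ ball p r →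
      Tendsto (fun j => fderiv ℂ ((eapp f)^[k (l j)]) z) atTop (𝓝 A) := by
    intro z
    by_cases hz : z ∈ ball p r
    · obtain ⟨A, hA⟩ := cauchySeq_tendsto_of_complete (hc.cauchySeq hz)
      exact ⟨A, fun _ => hA⟩
    · exact ⟨0, fun h => absurd h hz⟩
  choose g' hg' using hg'
  have hu' := hc.tendstoUniformlyOn_of_tendsto hg'
  refine ⟨g0, ?_, (hunif.mono hsub2).tendstoLocallyUniformlyOn⟩
  intro z hz
  refine (hasFDerivAt_of_tendstoUniformlyOn isOpen_ball hu' 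
    (fun j z _ => (iter_diff f _ z).hasFDerivAt) 
    (fun z hz => hunif.tendsto_at (hsub2 hz)) hz).differentiableAt.differentiableWithinAt

lemma escape (f : Endo n) {U : Set (Cn n)} (oU : IsOpen U) (hU : (U ∩ Julia f).Nonempty) (R : ℝ) :
    ∃ k, ∃ x ∈ U, R < ‖(eapp f)^[k] x‖ := by
  by_contra! hcon
  obtain ⟨p, hp, hJ⟩ := hU
  exact hJ (fatou_of_bdd f oU hp hcon)

/-- nondegenerate maps: derivative invertible on a dense set -/
def NonDeg (f : Endo n) : Prop := Dense {w | IsUnit (fderiv ℂ (eapp f) w)}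

lemma map_nhds_of_unit {F : Cn n → Cn n} (hF : Differentiable ℂ F) {x : Cn n}
    (hx : IsUnit (fderiv ℂ F x)) : map F (𝓝 x) = 𝓝 (F x) := by
  obtain ⟨u, hu⟩ := hx
  have hs : HasStrictFDerivAt F (fderiv ℂ F x) x :=
    hasStrictFDerivAt_of_hasFDerivAt_of_continuousAt
      (Eventually.of_forall fun z => (hF z).hasFDerivAt) (cont_fderiv hF).continuousAt
  rw [← hu] at hs
  exact HasStrictFDerivAt.map_nhds_eq_of_equiv
    (f' := ContinuousLinearEquiv.unitsEquiv ℂ (Cn n) u) hs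

lemma exists_unit_iter {f : Endo n} (hf : NonDeg f) (k : ℕ) {O : Set (Cn n)} (oO : IsOpen O)
    (hO : O.Nonempty) : ∃ x ∈ O, IsUnit (fderiv ℂ ((eapp f)^[k]) x) := by
  induction k with
  | zero =>
    obtain ⟨x, hx⟩ := hO
    refine ⟨x, hx, ?_⟩
    have : fderiv ℂ ((eapp f)^[0]) x = 1 := fderiv_id
    rw [this]; exact isUnit_one
  | succ k ih =>
    obtain ⟨x, hx, hu⟩ := ih
    have e : ∀ᶠ z in 𝓝 x, z ∈ O ∧ IsUnit (fderiv ℂ ((eapp f)^[k]) z) :=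
      (oO.eventually_mem hx).and ((cont_fderiv (iter_diff f k)).continuousAt.eventually
        (Units.isOpen.mem_nhds hu))
    have himg : (eapp f)^[k] '' {z | z ∈ O ∧ IsUnit (fderiv ℂ ((eapp f)^[k]) z)} ∈
        𝓝 ((eapp f)^[k] x) := by
      rw [← map_nhds_of_unit (iter_diff f k) hu]
      exact image_mem_map e
    obtain ⟨w, hw, z, ⟨hz, hzu⟩, rfl⟩ := hf.inter_nhds_nonempty himg
    refine ⟨z, hz, ?_⟩
    rw [Function.iterate_succ', fderiv_comp z (eapp_diff f _) (iter_diff f k z)]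
    exact IsUnit.mul hw hzu

lemma fderiv_iter_add (g : Endo n) (a b : ℕ) (x : Cn n) :
    fderiv ℂ ((eapp g)^[a + b]) x =
      fderiv ℂ ((eapp g)^[a]) ((eapp g)^[b] x) * fderiv ℂ ((eapp g)^[b]) x := by
  rw [Function.iterate_add, fderiv_comp x (iter_diff g a _) (iter_diff g b x)]
  rfl

lemma orbit_eq {f g : Endo n} {x : Cn n} {k : ℕ}
    (h : ∀ i < k, eapp g ((eapp f)^[i] x) = eapp f ((eapp f)^[i] x) ∧
      fderiv ℂ (eapp g) ((eapp f)^[i] x) = fderiv ℂ (eapp f) ((eapp f)^[i] x)) :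
    (eapp g)^[k] x = (eapp f)^[k] x ∧
      fderiv ℂ ((eapp g)^[k]) x = fderiv ℂ ((eapp f)^[k]) x := by
  induction k with
  | zero => exact ⟨rfl, rfl⟩
  | succ k ih =>
    obtain ⟨h1, h2⟩ := ih (fun i hi => h i (by omega))
    obtain ⟨h3, h4⟩ := h k (by omega)
    refine ⟨?_, ?_⟩
    · rw [Function.iterate_succ_apply', Function.iterate_succ_apply', h1, h3]
    · rw [Function.iterate_succ', Function.iterate_succ',
        fderiv_comp x (eapp_diff g _) (iter_diff g k x),
        fderiv_comp x (eapp_diff f _) (iter_diff f k x), h1, h2, h4]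

lemma exists_orbit {f : Endo n} {U : Set (Cn n)} (oU : IsOpen U) {R : ℝ}
    (hU : (U ∩ Julia f).Nonempty) :
    ∃ k : ℕ, ∃ O ⊆ U, IsOpen O ∧ O.Nonempty ∧ ∀ x ∈ O, R < ‖(eapp f)^[k] x‖ ∧
      ∀ i < k, ‖(eapp f)^[i] x‖ ≤ R := by
  classical
  have h := escape f oU hU R
  refine ⟨Nat.find h, {x | x ∈ U ∧ R < ‖(eapp f)^[Nat.find h] x‖}, fun x hx => hx.1, ?_, ?_, ?_⟩
  · exact oU.inter (isOpen_lt continuous_const (iter_diff f _).continuous.norm)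
  · obtain ⟨x, hx, hx'⟩ := Nat.find_spec h
    exact ⟨x, hx, hx'⟩
  · rintro x ⟨hx, hx'⟩
    refine ⟨hx', fun i hi => ?_⟩
    have := Nat.find_min h hi
    push Not at this
    exact this x hx

lemma pert (hn : 1 ≤ n) {f : Endo n} (hf : NonDeg f) {U V : Set (Cn n)} (oU : IsOpen U)
    (oV : IsOpen V) (hU : (U ∩ Julia f).Nonempty) (hV : (V ∩ Julia f).Nonempty) {R ε : ℝ}
    (hR : 0 < R) (hε : 0 < ε) :
    ∃ g : Endo n, (∀ z ∈ closedBall (0 : Cn n) R, dist (eapp f z) (eapp g z) ≤ ε) ∧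
      ∀ᶠ g' in 𝓝 g, HasCyc g' U V := by
  obtain ⟨k, O₁, hO₁, oO₁, ne₁, H₁⟩ := exists_orbit (R := R) oU hU
  obtain ⟨l, O₂, hO₂, oO₂, ne₂, H₂⟩ := exists_orbit (R := R) oV hV
  obtain ⟨x, hx, ux⟩ := exists_unit_iter hf k oO₁ ne₁
  obtain ⟨y, hy, hyx, uy⟩ : ∃ y ∈ O₂, (eapp f)^[l] y ≠ (eapp f)^[k] x ∧
      IsUnit (fderiv ℂ ((eapp f)^[l]) y) := by
    obtain ⟨y, hy, uy⟩ := exists_unit_iter hf l oO₂ ne₂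
    have e : ∀ᶠ z in 𝓝 y, z ∈ O₂ ∧ IsUnit (fderiv ℂ ((eapp f)^[l]) z) :=
      (oO₂.eventually_mem hy).and ((cont_fderiv (iter_diff f l)).continuousAt.eventually
        (Units.isOpen.mem_nhds uy))
    by_contra! hcon
    have e2 : ∀ᶠ w in 𝓝 ((eapp f)^[l] y), w = (eapp f)^[k] x := by
      rw [← map_nhds_of_unit (iter_diff f l) uy, eventually_map]
      filter_upwards [e] with z hz
      by_contra hne
      exact hcon z hz.1 hne hz.2
    have : Nontrivial (Cn n) := by
      have : Nonempty (Fin n) := ⟨⟨0, hn⟩⟩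
      infer_instance
    have : (𝓝[≠] ((eapp f)^[l] y)).NeBot := Module.punctured_nhds_neBot ℂ (Cn n) _
    obtain ⟨w, hw, hw'⟩ := ((e2.filter_mono nhdsWithin_le_nhds).and
      (self_mem_nhdsWithin (a := (eapp f)^[l] y) (s := {(eapp f)^[l] y}ᶜ))).exists
    exact hw' (hw.trans e2.self_of_nhds.symm)
  obtain ⟨hxR, hxi⟩ := H₁ x hx
  obtain ⟨hyR, hyi⟩ := H₂ y hy
  set a := (eapp f)^[k] x with ha
  set b := (eapp f)^[l] y with hb
  obtain ⟨A, hA⟩ := ux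
  obtain ⟨B, hB⟩ := uy
  let S : Set (Cn n) := (fun i => (eapp f)^[i] x) '' Set.Iio k ∪ (fun i => (eapp f)^[i] y) '' Set.Iio l
  have hSfin : S.Finite := ((Set.finite_Iio k).image _).union ((Set.finite_Iio l).image _)
  have hSR : ∀ s ∈ S, ‖s‖ ≤ R := by
    rintro s (⟨i, hi, rfl⟩ | ⟨i, hi, rfl⟩)
    · exact hxi i hi
    · exact hyi i hi
  have haS : a ∉ insert b S := by
    rintro (h | h)
    · exact hyx h.symm
    · exact absurd (hSR a h) (not_le.2 hxR)
  have hbS : b ∉ insert a S := by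
    rintro (h | h)
    · exact hyx h
    · exact absurd (hSR b h) (not_le.2 hyR)
  obtain ⟨h₁, d₁, v₁, D₁, s₁, n₁⟩ := exists_pert a _ (hSfin.insert b) haS hR hxR (half_pos hε)
    (y - eapp f a) ((↑A⁻¹ : Cn n →L[ℂ] Cn n) - fderiv ℂ (eapp f) a)
  obtain ⟨h₂, d₂, v₂, D₂, s₂, n₂⟩ := exists_pert b _ (hSfin.insert a) hbS hR hyR (half_pos hε)
    (x - eapp f b) ((2 : ℂ) • (↑B⁻¹ : Cn n →L[ℂ] Cn n) - fderiv ℂ (eapp f) b)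
  have dg : Differentiable ℂ (fun z => eapp f z + (h₁ z + h₂ z)) :=
    (eapp_diff f).add (d₁.add d₂)
  let g : Endo n := ⟨⟨fun z => eapp f z + (h₁ z + h₂ z), dg.continuous⟩, dg⟩
  have gval : ∀ z, eapp g z = eapp f z + (h₁ z + h₂ z) := fun z => rfl
  have gder : ∀ z, fderiv ℂ (eapp g) z = fderiv ℂ (eapp f) z + (fderiv ℂ h₁ z + fderiv ℂ h₂ z) :=
    fun z => ((eapp_diff f z).hasFDerivAt.add
      ((d₁ z).hasFDerivAt.add (d₂ z).hasFDerivAt)).fderiv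
  have gS : ∀ s ∈ S, eapp g s = eapp f s ∧ fderiv ℂ (eapp g) s = fderiv ℂ (eapp f) s := by
    intro s hs
    have e1 := s₁ s (Or.inr hs)
    have e2 := s₂ s (Or.inr hs)
    rw [gval, gder, e1.1, e1.2, e2.1, e2.2]
    simp
  have ga : eapp g a = y := by
    rw [gval, v₁, (s₂ a (Or.inl rfl)).1]; abel
  have gb : eapp g b = x := by
    rw [gval, v₂, (s₁ b (Or.inl rfl)).1]; abel
  have gDa : fderiv ℂ (eapp g) a = (↑A⁻¹ : Cn n →L[ℂ] Cn n) := by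
    rw [gder, D₁, (s₂ a (Or.inl rfl)).2]; abel
  have gDb : fderiv ℂ (eapp g) b = (2 : ℂ) • (↑B⁻¹ : Cn n →L[ℂ] Cn n) := by
    rw [gder, D₂, (s₁ b (Or.inl rfl)).2]; abel
  obtain ⟨ox, oDx⟩ := orbit_eq (f := f) (g := g) (x := x) (k := k)
    (fun i hi => gS _ (Or.inl ⟨i, hi, rfl⟩))
  obtain ⟨oy, oDy⟩ := orbit_eq (f := f) (g := g) (x := y) (k := l)
    (fun i hi => gS _ (Or.inr ⟨i, hi, rfl⟩))
  have i1 : (eapp g)^[1 + k] x = y := by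
    rw [Function.iterate_add_apply, ox, ← ha, Function.iterate_one, ga]
  have i2 : (eapp g)^[l + (1 + k)] x = b := by
    rw [Function.iterate_add_apply, i1, oy]
  have i3 : (eapp g)^[1 + (l + (1 + k))] x = x := by
    rw [Function.iterate_add_apply, i2, Function.iterate_one, gb]
  have hD : fderiv ℂ ((eapp g)^[1 + (l + (1 + k))]) x =
      (2 : ℂ) • ContinuousLinearMap.id ℂ (Cn n) := by
    rw [fderiv_iter_add, i2, fderiv_iter_add, i1, fderiv_iter_add, ox, oDx, oDy, ← ha,
      Function.iterate_one, gDa, gDb, ← hA, ← hB, Units.inv_mul, mul_one, smul_mul_assoc,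
      Units.inv_mul]
    rfl
  refine ⟨g, ?_, robust (by omega) i3 hD oU oV (hO₁ hx) (j := 1 + k) (by rw [i1]; exact hO₂ hy)⟩
  intro z hz
  rw [gval, dist_self_add_right]
  refine (norm_add_le _ _).trans ?_
  linarith [n₁ z hz, n₂ z hz]

lemma mem_closure_endo {f : Endo n} {A : Set (Endo n)}
    (h : ∀ R ε : ℝ, 0 < R → 0 < ε → ∃ g ∈ A, ∀ z ∈ closedBall (0 : Cn n) R,
      dist (eapp f z) (eapp g z) ≤ ε) : f ∈ closure A := by
  have hN : ∀ N : ℕ, ∃ g ∈ A, ∀ z ∈ closedBall (0 : Cn n) ((N : ℝ) + 1),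
      dist (eapp f z) (eapp g z) ≤ 1 / ((N : ℝ) + 1) :=
    fun N => h _ _ (by positivity) (by positivity)
  choose g hgA hg using hN
  refine mem_closure_of_tendsto (f := g) (b := atTop) ?_ (Eventually.of_forall hgA)
  rw [tendsto_subtype_rng, ContinuousMap.tendsto_iff_forall_isCompact_tendstoUniformlyOn]
  intro K hK
  rw [Metric.tendstoUniformlyOn_iff]
  intro ε hε
  obtain ⟨R, hR⟩ := hK.isBounded.subset_closedBall (0 : Cn n)
  obtain ⟨N0, hN0⟩ := exists_nat_ge R
  filter_upwards [eventually_ge_atTop N0,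
    tendsto_one_div_add_atTop_nhds_zero_nat.eventually (Iio_mem_nhds hε)] with N h1 h2 z hz
  refine (hg N z ?_).trans_lt h2
  refine closedBall_subset_closedBall ?_ (hR hz)
  have : (N0 : ℝ) ≤ N := by exact_mod_cast h1
  linarith

lemma residual_unit (w : Cn n) : {f : Endo n | IsUnit (fderiv ℂ (eapp f) w)} ∈ residual (Endo n) := by
  refine residual_of_dense_open (Units.isOpen.preimage (cont_fderiv_endo w)) ?_
  intro f
  apply mem_closure_endo
  intro R ε hR hε
  have hfin : (spectrum ℂ (-fderiv ℂ (eapp f) w)).Finite := by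
    rw [ContinuousLinearMap.spectrum_eq]
    exact Module.End.finite_spectrum _
  have : ∃ t : ℝ, t ∈ Set.Ioo 0 (ε / R) ∧ (t : ℂ) ∉ spectrum ℂ (-fderiv ℂ (eapp f) w) := by
    have hinf : (Set.Ioo 0 (ε / R)).Infinite := Set.Ioo_infinite (by positivity)
    obtain ⟨t, ht, ht'⟩ := hinf.exists_notMem_finite
      (hfin.preimage (f := ((↑) : ℝ → ℂ)) Complex.ofReal_injective.injOn)
    exact ⟨t, ht, ht'⟩
  obtain ⟨t, ⟨ht0, ht1⟩, ht⟩ := this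
  have dg : Differentiable ℂ (fun z => eapp f z + (t : ℂ) • z) := 
    (eapp_diff f).add (by fun_prop)
  refine ⟨⟨⟨_, dg.continuous⟩, dg⟩, ?_, ?_⟩
  · change IsUnit (fderiv ℂ (fun z => eapp f z + (t : ℂ) • z) w)
    rw [spectrum.notMem_iff] at ht
    convert ht using 1
    rw [sub_neg_eq_add, add_comm, Algebra.algebraMap_eq_smul_one]
    exact ((eapp_diff f w).hasFDerivAt.add ((hasFDerivAt_id w).const_smul (t : ℂ))).fderiv
  · intro z hz
    change dist (eapp f z) (eapp f z + (t : ℂ) • z) ≤ ε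
    rw [dist_self_add_right, norm_smul, Complex.norm_real, Real.norm_of_nonneg ht0.le]
    rw [mem_closedBall_zero_iff] at hz
    rw [lt_div_iff₀ hR] at ht1
    nlinarith

lemma residual_nonDeg : {f : Endo n | NonDeg f} ∈ residual (Endo n) := by
  obtain ⟨D, hDc, hD⟩ := TopologicalSpace.exists_countable_dense (Cn n)
  filter_upwards [(countable_bInter_mem hDc).2 (fun w _ => residual_unit w)] with f hf
  exact hD.mono (fun w hw => Set.mem_iInter₂.1 hf w hw)

lemma residual_alt {X : Type*} [TopologicalSpace X] (A : Set X) :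
    interior A ∪ (closure (interior A))ᶜ ∈ residual X := by
  refine residual_of_dense_open (isOpen_interior.union isClosed_closure.isOpen_compl) ?_
  intro x
  by_cases hx : x ∈ closure (interior A)
  · exact closure_mono Set.subset_union_left hx
  · exact subset_closure (Or.inr hx)

/-- A generic endomorphism of `ℂⁿ` is chaotic on its Julia set in the sense of Touhey: every
two nonempty open sets meeting `J_f` are visited by a common repelling cycle. -/
theorem stmt_14 (n : ℕ) (hn : 1 ≤ n) :
    {f : Endo n | ∀ U V : Set (Cn n), IsOpen U → IsOpen V →
      (U ∩ Julia f).Nonempty → (V ∩ Julia f).Nonempty →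
      ∃ p : Cn n, IsRepPer f p ∧ (∃ i < minPer f p, (eapp f)^[i] p ∈ U) ∧
        (∃ j < minPer f p, (eapp f)^[j] p ∈ V)} ∈ residual (Endo n) := by
  have hc : {f : Endo n | ∀ U ∈ TopologicalSpace.countableBasis (Cn n),
      ∀ V ∈ TopologicalSpace.countableBasis (Cn n),
      f ∈ interior {g : Endo n | HasCyc g U V} ∪ (closure (interior {g : Endo n | HasCyc g U V}))ᶜ}
      ∈ residual (Endo n) := by
    have hcb := TopologicalSpace.countable_countableBasis (Cn n)
    have := (countable_bInter_mem hcb).2 (fun U _ => (countable_bInter_mem hcb).2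
      (fun V _ => residual_alt {g : Endo n | HasCyc g U V}))
    filter_upwards [this] with f hf U hU V hV
    exact Set.mem_iInter₂.1 (Set.mem_iInter₂.1 hf U hU) V hV
  filter_upwards [residual_nonDeg, hc] with f hf hcf U V oU oV hU hV
  have hb := TopologicalSpace.isBasis_countableBasis (Cn n)
  obtain ⟨u, hu, huJ⟩ := hU
  obtain ⟨v, hv, hvJ⟩ := hV
  obtain ⟨U', hU', huU', hsU⟩ := hb.exists_subset_of_mem_open hu oU
  obtain ⟨V', hV', hvV', hsV⟩ := hb.exists_subset_of_mem_open hv oV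
  have hcl : f ∈ closure (interior {g : Endo n | HasCyc g U' V'}) := by
    apply mem_closure_endo
    intro R ε hR hε
    obtain ⟨g, hg, hg'⟩ := pert hn hf (hb.isOpen hU') (hb.isOpen hV') ⟨u, huU', huJ⟩
      ⟨v, hvV', hvJ⟩ hR hε
    exact ⟨g, mem_interior_iff_mem_nhds.2 hg', hg⟩
  have hin : HasCyc f U' V' := by
    rcases hcf U' hU' V' hV' with h | h
    · exact (interior_subset h : f ∈ {g : Endo n | HasCyc g U' V'})
    · exact absurd hcl h
  obtain ⟨p, hp, ⟨i, hi, hiU⟩, ⟨j, hj, hjV⟩⟩ := hin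
  exact ⟨p, hp, ⟨i, hi, hsU hiU⟩, ⟨j, hj, hsV hjV⟩⟩
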